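/- arXiv:2604.21002 — 5 statements merged into one kernel-verified Lean document; each statement's English description precedes it below -/
import Mathlib

section
/- Let K > 0 and let L ≥ 0 satisfy L < π/(2·√K). Let u : ℝ → ℝ be twice differentiable with u(0) > 0, u'(0) = 0, and u''(s) + K·u(s) ≥ 0 for all s ∈ [0, L]. Then u(s) ≥ u(0)·cos(√K·s) for every s ∈ [0, L]. -/
/-- Trigonometric Sturm comparison. -/
theorem stmt_2 (K L : ℝ) (hK : 0 < K) (hL : 0 ≤ L) (hL' : L < Real.pi / (2 * Real.sqrt K))
    (u : ℝ → ℝ) (hu : Differentiable ℝ u) (hu' : Differentiable ℝ (deriv u))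
    (hu0 : 0 < u 0) (hu'0 : deriv u 0 = 0)
    (hineq : ∀ s ∈ Set.Icc (0 : ℝ) L, 0 ≤ deriv (deriv u) s + K * u s) :
    ∀ s ∈ Set.Icc (0 : ℝ) L, u 0 * Real.cos (Real.sqrt K * s) ≤ u s := by
  have hk : 0 < Real.sqrt K := Real.sqrt_pos.mpr hK
  have hkk : Real.sqrt K * Real.sqrt K = K := Real.mul_self_sqrt hK.le
  generalize Real.sqrt K = k at *
  have hcos : ∀ s ∈ Set.Icc (0 : ℝ) L, 0 < Real.cos (k * s) := by
    intro s hs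
    have h1 : L * (2 * k) < Real.pi := (lt_div_iff₀ (by positivity)).mp hL'
    have h2 : k * s ≤ k * L := mul_le_mul_of_nonneg_left hs.2 hk.le
    have h3 : 0 ≤ k * s := mul_nonneg hk.le hs.1
    apply Real.cos_pos_of_mem_Ioo
    constructor <;> linarith [Real.pi_pos]
  have hlin : ∀ s : ℝ, HasDerivAt (fun s => k * s) k s := fun s => by
    simpa using (hasDerivAt_id s).const_mul k
  have hW : ∀ s, HasDerivAt (fun s => deriv u s * Real.cos (k * s) + k * (u s * Real.sin (k * s)))
      ((deriv (deriv u) s + K * u s) * Real.cos (k * s)) s := by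
    intro s
    have := ((hu' s).hasDerivAt.mul (hlin s).cos).add
      (((hu s).hasDerivAt.mul (hlin s).sin).const_mul k)
    refine this.congr_deriv ?_
    rw [← hkk]; ring
  have hWm := monotoneOn_of_deriv_nonneg (convex_Icc (0 : ℝ) L)
    (fun s _ => (hW s).continuousAt.continuousWithinAt)
    (fun s _ => (hW s).differentiableAt.differentiableWithinAt)
    (fun s hs => by
      rw [(hW s).deriv]
      exact mul_nonneg (hineq s (interior_subset hs)) (hcos s (interior_subset hs)).le)
  have hW0 : ∀ s ∈ Set.Icc (0 : ℝ) L,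
      0 ≤ deriv u s * Real.cos (k * s) + k * (u s * Real.sin (k * s)) := by
    intro s hs
    have := hWm (Set.left_mem_Icc.mpr hL) hs hs.1
    simpa [hu'0] using this
  have hQ : ∀ s ∈ Set.Icc (0 : ℝ) L, HasDerivAt (fun s => u s / Real.cos (k * s))
      ((deriv u s * Real.cos (k * s) + k * (u s * Real.sin (k * s))) / Real.cos (k * s) ^ 2) s := by
    intro s hs
    refine ((hu s).hasDerivAt.div (hlin s).cos (hcos s hs).ne').congr_deriv ?_
    congr 1; ring
  have hQm := monotoneOn_of_deriv_nonneg (convex_Icc (0 : ℝ) L)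
    (fun s hs => (hQ s hs).continuousAt.continuousWithinAt)
    (fun s hs => (hQ s (interior_subset hs)).differentiableAt.differentiableWithinAt)
    (fun s hs => by
      rw [(hQ s (interior_subset hs)).deriv]
      exact div_nonneg (hW0 s (interior_subset hs)) (sq_nonneg _))
  intro s hs
  have := hQm (Set.left_mem_Icc.mpr hL) hs hs.1
  simp only [mul_zero, Real.cos_zero, div_one] at this
  exact (le_div_iff₀ (hcos s hs)).mp this
end

section
/- Let H > 0 and L ≥ 0. Let u : ℝ → ℝ be twice differentiable with u(0) > 0, u'(0) = 0, and u''(s) ≤ H·u(s) for all s ∈ [0, L]. Then u(s) ≤ u(0)·cosh(√H·s) for every s ∈ [0, L]. -/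
/-- Hyperbolic comparison. -/
theorem stmt_3 (H L : ℝ) (hH : 0 < H) (hL : 0 ≤ L)
    (u : ℝ → ℝ) (hu : Differentiable ℝ u) (hu' : Differentiable ℝ (deriv u))
    (hu0 : 0 < u 0) (hu'0 : deriv u 0 = 0)
    (hineq : ∀ s ∈ Set.Icc (0 : ℝ) L, deriv (deriv u) s ≤ H * u s) :
    ∀ s ∈ Set.Icc (0 : ℝ) L, u s ≤ u 0 * Real.cosh (Real.sqrt H * s) := by
  obtain ⟨k, hk⟩ : ∃ k, k = Real.sqrt H := ⟨_, rfl⟩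
  have hkk : k * k = H := by rw [hk]; exact Real.mul_self_sqrt hH.le
  rw [← hk]
  have hlin : ∀ s : ℝ, HasDerivAt (fun s : ℝ => k * s) k s := fun s => by
    simpa using (hasDerivAt_id s).const_mul k
  have hc : ∀ s : ℝ, HasDerivAt (fun s : ℝ => Real.cosh (k * s)) (Real.sinh (k * s) * k) s :=
    fun s => (hlin s).cosh
  have hs : ∀ s : ℝ, HasDerivAt (fun s : ℝ => Real.sinh (k * s)) (Real.cosh (k * s) * k) s :=
    fun s => (hlin s).sinh
  have hW : ∀ s : ℝ, HasDerivAt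
      (fun s : ℝ => deriv u s * Real.cosh (k * s) - u s * (Real.sinh (k * s) * k))
      ((deriv (deriv u) s - H * u s) * Real.cosh (k * s)) s := fun s => by
    have h := ((hu' s).hasDerivAt.mul (hc s)).sub
      ((hu s).hasDerivAt.mul ((hs s).mul_const k))
    refine h.congr_deriv ?_
    rw [← hkk]; ring
  have hWanti : AntitoneOn
      (fun s : ℝ => deriv u s * Real.cosh (k * s) - u s * (Real.sinh (k * s) * k))
      (Set.Icc 0 L) := by
    refine antitoneOn_of_deriv_nonpos (convex_Icc 0 L)
      (fun s _ => (hW s).continuousAt.continuousWithinAt)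
      (fun s _ => (hW s).differentiableAt.differentiableWithinAt) ?_
    intro s hs'
    rw [(hW s).deriv]
    have := hineq s (interior_subset hs')
    exact mul_nonpos_of_nonpos_of_nonneg (by linarith) (Real.cosh_pos _).le
  have hq : ∀ s : ℝ, HasDerivAt (fun s : ℝ => u s / Real.cosh (k * s))
      ((deriv u s * Real.cosh (k * s) - u s * (Real.sinh (k * s) * k))
        / Real.cosh (k * s) ^ 2) s := fun s =>
    (hu s).hasDerivAt.div (hc s) (Real.cosh_pos _).ne'
  have hqanti : AntitoneOn (fun s : ℝ => u s / Real.cosh (k * s)) (Set.Icc 0 L) := by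
    refine antitoneOn_of_deriv_nonpos (convex_Icc 0 L)
      (fun s _ => (hq s).continuousAt.continuousWithinAt)
      (fun s _ => (hq s).differentiableAt.differentiableWithinAt) ?_
    intro s hs'
    rw [(hq s).deriv]
    have hm := interior_subset hs'
    have h := hWanti (Set.left_mem_Icc.2 hL) hm hm.1
    simp only [hu'0, mul_zero, Real.sinh_zero, zero_mul, sub_zero] at h
    exact div_nonpos_of_nonpos_of_nonneg h (sq_nonneg _)
  intro s hm
  have h := hqanti (Set.left_mem_Icc.2 hL) hm hm.1
  simp only [mul_zero, Real.cosh_zero, div_one] at h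
  exact (div_le_iff₀ (Real.cosh_pos _)).1 h
end

section
/- Let m > 0 and let c < λ be real numbers. Let L ≥ 0 and let f : ℝ → ℝ be twice differentiable with f'(0) = 0, f(0) ≤ f(L), and f''(s) − (1/m)·f'(s)² ≤ λ − c for all s ∈ [0, L]. Then L ≥ √(m/(λ − c)) · arccos( exp( −(f(L) − f(0))/m ) ). -/
/-- ODE form of diameter estimate (1) of Theorem 3. -/
theorem stmt_4 (m c lam : ℝ) (hm : 0 < m) (hc : c < lam) (L : ℝ) (hL : 0 ≤ L)
    (f : ℝ → ℝ) (hf : Differentiable ℝ f) (hf' : Differentiable ℝ (deriv f))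
    (hf0 : deriv f 0 = 0) (hfL : f 0 ≤ f L)
    (hineq : ∀ s ∈ Set.Icc (0 : ℝ) L,
      deriv (deriv f) s - (1 / m) * (deriv f s) ^ 2 ≤ lam - c) :
    Real.sqrt (m / (lam - c)) * Real.arccos (Real.exp (-(f L - f 0) / m)) ≤ L := by
  have hd : 0 < lam - c := sub_pos.2 hc
  set k := Real.sqrt ((lam - c) / m) with hk
  have hkpos : 0 < k := Real.sqrt_pos.2 (by positivity)
  have hk2 : k ^ 2 = (lam - c) / m := Real.sq_sqrt (by positivity)
  have hinv : Real.sqrt (m / (lam - c)) = k⁻¹ := by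
    rw [hk, ← Real.sqrt_inv, inv_div]
  rw [hinv, inv_mul_le_iff₀ hkpos]
  rcases le_or_gt (Real.pi / 2) (k * L) with h | h
  · exact le_trans (Real.arccos_le_pi_div_two.2 (Real.exp_pos _).le) h
  set u : ℝ → ℝ := fun s => Real.exp (-(f s - f 0) / m) with hu
  have hupos : ∀ s, 0 < u s := fun s => Real.exp_pos _
  have hu1 : ∀ s, HasDerivAt u (u s * (-(deriv f s) / m)) s := fun s =>
    ((((hf s).hasDerivAt.sub_const (f 0)).neg).div_const m).exp
  have hlin : ∀ s : ℝ, HasDerivAt (fun s => k * s) k s := fun s => by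
    simpa using (hasDerivAt_id s).const_mul k
  have hcos : ∀ s : ℝ, HasDerivAt (fun s => Real.cos (k * s)) (-Real.sin (k * s) * k) s :=
    fun s => (hlin s).cos
  have hsin : ∀ s : ℝ, HasDerivAt (fun s => Real.sin (k * s)) (Real.cos (k * s) * k) s :=
    fun s => (hlin s).sin
  have hcpos : ∀ s ∈ Set.Icc (0 : ℝ) L, 0 < Real.cos (k * s) := fun s hs => by
    apply Real.cos_pos_of_mem_Ioo
    have h1 : k * s ≤ k * L := mul_le_mul_of_nonneg_left hs.2 hkpos.le
    have h2 : 0 ≤ k * s := mul_nonneg hkpos.le hs.1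
    constructor <;> linarith [Real.pi_pos]
  set W : ℝ → ℝ := fun s =>
    (u s * (-(deriv f s) / m)) * Real.cos (k * s) + k * (u s * Real.sin (k * s)) with hW
  have hW1 : ∀ s, HasDerivAt W
      (u s * Real.cos (k * s) * (k ^ 2 - (deriv (deriv f) s - (1 / m) * (deriv f s) ^ 2) / m)) s := by
    intro s
    have h1 := (((hu1 s).mul (((hf' s).hasDerivAt.neg).div_const m)).mul (hcos s)).add
      (((hu1 s).mul (hsin s)).const_mul k)
    refine h1.congr_deriv ?_
    simp only [Pi.mul_apply, Pi.neg_apply]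
    field_simp
    ring
  have hWmono : MonotoneOn W (Set.Icc 0 L) := by
    apply monotoneOn_of_deriv_nonneg (convex_Icc 0 L)
    · exact fun s _ => (hW1 s).continuousAt.continuousWithinAt
    · exact fun s _ => (hW1 s).differentiableAt.differentiableWithinAt
    · intro s hs
      have hs' := interior_subset hs
      rw [(hW1 s).deriv, hk2]
      have := div_le_div_of_nonneg_right (hineq s hs') hm.le
      exact mul_nonneg (mul_pos (hupos s) (hcpos s hs')).le (by linarith)
  have hW0 : W 0 = 0 := by simp [hW, hf0]
  have h0 : (0 : ℝ) ∈ Set.Icc 0 L := ⟨le_rfl, hL⟩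
  have hLm : L ∈ Set.Icc 0 L := ⟨hL, le_rfl⟩
  have hV1 : ∀ s ∈ Set.Icc (0 : ℝ) L, HasDerivAt (fun s => u s / Real.cos (k * s))
      (W s / Real.cos (k * s) ^ 2) s := fun s hs => by
    refine ((hu1 s).div (hcos s) (hcpos s hs).ne').congr_deriv ?_
    simp only [hW]
    ring
  have hVmono : MonotoneOn (fun s => u s / Real.cos (k * s)) (Set.Icc 0 L) := by
    apply monotoneOn_of_deriv_nonneg (convex_Icc 0 L)
    · exact fun s hs => (hV1 s hs).continuousAt.continuousWithinAt
    · exact fun s hs => (hV1 s (interior_subset hs)).differentiableAt.differentiableWithinAt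
    · intro s hs
      have hs' := interior_subset hs
      rw [(hV1 s hs').deriv]
      have := hWmono h0 hs' hs'.1
      rw [hW0] at this
      exact div_nonneg this (sq_nonneg _)
  have hfin := hVmono h0 hLm hL
  have hu0 : u 0 = 1 := by simp [hu]
  simp only [hu0, mul_zero, Real.cos_zero, div_one] at hfin
  rw [le_div_iff₀ (hcpos L hLm), one_mul] at hfin
  have hkL : 0 ≤ k * L := mul_nonneg hkpos.le hL
  calc Real.arccos (u L) ≤ Real.arccos (Real.cos (k * L)) := Real.arccos_le_arccos hfin
    _ = k * L := Real.arccos_cos hkL (by linarith [Real.pi_pos])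
end

section
/- Let m > 0 and let λ < C be real numbers. Let L ≥ 0 and let f : ℝ → ℝ be twice differentiable with f'(0) = 0 and f''(s) − (1/m)·f'(s)² ≥ λ − C for all s ∈ [0, L]. Then exp( (f(0) − f(L))/m ) ≤ cosh( √((C − λ)/m) · L ). -/
/-- ODE form of diameter estimate (2) of Theorem 3. -/
theorem stmt_5 (m lam C : ℝ) (hm : 0 < m) (hC : lam < C) (L : ℝ) (hL : 0 ≤ L)
    (f : ℝ → ℝ) (hf : Differentiable ℝ f) (hf' : Differentiable ℝ (deriv f))
    (hf0 : deriv f 0 = 0)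
    (hineq : ∀ s ∈ Set.Icc (0 : ℝ) L,
      lam - C ≤ deriv (deriv f) s - (1 / m) * (deriv f s) ^ 2) :
    Real.exp ((f 0 - f L) / m) ≤ Real.cosh (Real.sqrt ((C - lam) / m) * L) := by
  set k := Real.sqrt ((C - lam) / m) with hk
  have hk2 : k * k = (C - lam) / m := Real.mul_self_sqrt (by
    apply div_nonneg <;> linarith)
  have hu : ∀ s, HasDerivAt (fun s => Real.exp ((f 0 - f s) / m))
      (Real.exp ((f 0 - f s) / m) * (-deriv f s / m)) s := fun s => by
    have h := (((hf s).hasDerivAt.const_sub (f 0)).div_const m).exp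
    exact h
  have hlin : ∀ s, HasDerivAt (fun s : ℝ => k * s) k s := fun s => by
    simpa using (hasDerivAt_id s).const_mul k
  have hc : ∀ s, HasDerivAt (fun s => Real.cosh (k * s)) (Real.sinh (k * s) * k) s :=
    fun s => (hlin s).cosh
  have hs : ∀ s, HasDerivAt (fun s => Real.sinh (k * s)) (Real.cosh (k * s) * k) s :=
    fun s => (hlin s).sinh
  have hd : ∀ s, HasDerivAt (fun s => -deriv f s / m) (-deriv (deriv f) s / m) s :=
    fun s => (hf' s).hasDerivAt.neg.div_const m
  let W : ℝ → ℝ := fun s => Real.exp ((f 0 - f s) / m) *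
    ((-deriv f s / m) * Real.cosh (k * s) - k * Real.sinh (k * s))
  have hW : ∀ s, HasDerivAt W (Real.exp ((f 0 - f s) / m) * Real.cosh (k * s) *
      ((deriv f s) ^ 2 / m ^ 2 - deriv (deriv f) s / m - k * k)) s := fun s => by
    have h := (hu s).mul (((hd s).mul (hc s)).sub ((hs s).const_mul k))
    refine HasDerivAt.congr_deriv h ?_
    simp only [Pi.mul_apply, Pi.sub_apply]
    field_simp
    ring
  have hWanti : AntitoneOn W (Set.Icc 0 L) := by
    apply antitoneOn_of_deriv_nonpos (convex_Icc 0 L)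
      (fun s _ => (hW s).continuousAt.continuousWithinAt)
      (fun s _ => (hW s).differentiableAt.differentiableWithinAt)
    intro s hs'
    have h := hineq s (interior_subset hs')
    rw [(hW s).deriv]
    apply mul_nonpos_of_nonneg_of_nonpos
    · exact mul_nonneg (Real.exp_pos _).le (Real.cosh_pos _).le
    · rw [hk2]
      have e : (deriv f s) ^ 2 / m ^ 2 - deriv (deriv f) s / m - (C - lam) / m =
        ((lam - C) - (deriv (deriv f) s - (1 / m) * (deriv f s) ^ 2)) / m := by
        field_simp
        ring
      rw [e]
      exact div_nonpos_of_nonpos_of_nonneg (by linarith) hm.le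
  have hW0 : W 0 = 0 := by simp [W, hf0]
  let V : ℝ → ℝ := fun s => Real.exp ((f 0 - f s) / m) / Real.cosh (k * s)
  have hV : ∀ s, HasDerivAt V (W s / Real.cosh (k * s) ^ 2) s := fun s => by
    have h := (hu s).div (hc s) (Real.cosh_pos _).ne'
    refine HasDerivAt.congr_deriv h ?_
    congr 1
    simp only [W]
    ring
  have hVanti : AntitoneOn V (Set.Icc 0 L) := by
    apply antitoneOn_of_deriv_nonpos (convex_Icc 0 L)
      (fun s _ => (hV s).continuousAt.continuousWithinAt)
      (fun s _ => (hV s).differentiableAt.differentiableWithinAt)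
    intro s hs'
    have hs2 := interior_subset hs'
    rw [(hV s).deriv]
    have := hWanti (Set.left_mem_Icc.2 hL) hs2 hs2.1
    exact div_nonpos_of_nonpos_of_nonneg (by linarith) (sq_nonneg _)
  have h := hVanti (Set.left_mem_Icc.2 hL) (Set.right_mem_Icc.2 hL) hL
  have hV0 : V 0 = 1 := by simp [V]
  rw [hV0] at h
  exact (div_le_one (Real.cosh_pos _)).1 h
end

section
/- Let m > 0 and let c < λ < C be real numbers. Let L ≥ 0 satisfy L < π·√(m/(λ − c)). Let f : ℝ → ℝ be twice differentiable with f'(0) = 0, f'(L) = 0, and λ − C ≤ f''(s) − (1/m)·f'(s)² ≤ λ − c for all s ∈ [0, L]. Then exp( (f(L) − f(0))/m ) ≤ cosh( √((C − λ)/m) · (L/2) ) / cos( √((λ − c)/m) · (L/2) ). -/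
theorem cmp_aux (p p1 p2 q q1 q2 : ℝ → ℝ) (T : ℝ) (hT : 0 ≤ T)
    (hp : ∀ s, HasDerivAt p (p1 s) s) (hp1 : ∀ s, HasDerivAt p1 (p2 s) s)
    (hq : ∀ s, HasDerivAt q (q1 s) s) (hq1 : ∀ s, HasDerivAt q1 (q2 s) s)
    (hp0 : p1 0 = 0) (hq0 : q1 0 = 0)
    (hpos : ∀ s ∈ Set.Icc (0 : ℝ) T, 0 < q s)
    (h : ∀ s ∈ Set.Icc (0 : ℝ) T, p s * q2 s ≤ p2 s * q s) :
    p 0 * q T ≤ p T * q 0 := by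
  have hW : ∀ s, HasDerivAt (fun s => p1 s * q s - p s * q1 s) (p2 s * q s - p s * q2 s) s := by
    intro s
    have := ((hp1 s).mul (hq s)).sub ((hp s).mul (hq1 s))
    exact this.congr_deriv (by ring)
  have hWm : MonotoneOn (fun s => p1 s * q s - p s * q1 s) (Set.Icc 0 T) := by
    apply monotoneOn_of_deriv_nonneg (convex_Icc 0 T)
    · exact fun s _ => (hW s).continuousAt.continuousWithinAt
    · exact fun s _ => (hW s).differentiableAt.differentiableWithinAt
    · intro s hs
      rw [(hW s).deriv]
      linarith [h s (interior_subset hs)]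
  have h0 : (0 : ℝ) ∈ Set.Icc 0 T := ⟨le_refl _, hT⟩
  have hR : ∀ s ∈ Set.Icc (0 : ℝ) T,
      HasDerivAt (fun s => p s / q s) ((p1 s * q s - p s * q1 s) / q s ^ 2) s :=
    fun s hs => (hp s).div (hq s) (hpos s hs).ne'
  have hRm : MonotoneOn (fun s => p s / q s) (Set.Icc 0 T) := by
    apply monotoneOn_of_deriv_nonneg (convex_Icc 0 T)
    · exact fun s hs => (hR s hs).continuousAt.continuousWithinAt
    · exact fun s hs => (hR s (interior_subset hs)).differentiableAt.differentiableWithinAt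
    · intro s hs
      have hs' := interior_subset hs
      rw [(hR s hs').deriv]
      have := hWm h0 hs' hs'.1
      simp only [hp0, hq0] at this
      apply div_nonneg _ (sq_nonneg _)
      linarith
  have hT' : T ∈ Set.Icc 0 T := ⟨hT, le_refl _⟩
  have := hRm h0 hT' hT
  simp only at this
  rwa [div_le_div_iff₀ (hpos 0 h0) (hpos T hT')] at this

/-- ODE form of the mixed estimate (Proposition 1.4). -/
theorem stmt_6 (m c lam C : ℝ) (hm : 0 < m) (hc : c < lam) (hC : lam < C)
    (L : ℝ) (hL : 0 ≤ L) (hL' : L < Real.pi * Real.sqrt (m / (lam - c)))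
    (f : ℝ → ℝ) (hf : Differentiable ℝ f) (hf' : Differentiable ℝ (deriv f))
    (hf0 : deriv f 0 = 0) (hfL : deriv f L = 0)
    (hineq : ∀ s ∈ Set.Icc (0 : ℝ) L,
      lam - C ≤ deriv (deriv f) s - (1 / m) * (deriv f s) ^ 2 ∧
      deriv (deriv f) s - (1 / m) * (deriv f s) ^ 2 ≤ lam - c) :
    Real.exp ((f L - f 0) / m) ≤
      Real.cosh (Real.sqrt ((C - lam) / m) * (L / 2)) /
        Real.cos (Real.sqrt ((lam - c) / m) * (L / 2)) := by
  set a := Real.sqrt ((lam - c) / m) with ha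
  set b := Real.sqrt ((C - lam) / m) with hb
  have ha2 : a ^ 2 * m = lam - c := by
    rw [ha, Real.sq_sqrt (div_nonneg (by linarith) hm.le)]; field_simp
  have hb2 : b ^ 2 * m = C - lam := by
    rw [hb, Real.sq_sqrt (div_nonneg (by linarith) hm.le)]; field_simp
  have hapos : 0 < a := Real.sqrt_pos.2 (div_pos (by linarith) hm)
  have haL : a * L < Real.pi := by
    have e : Real.sqrt (m / (lam - c)) = a⁻¹ := by
      rw [ha, ← Real.sqrt_inv, inv_div]
    rw [e, ← div_eq_mul_inv, lt_div_iff₀ hapos] at hL'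
    linarith
  have hcos : ∀ s ∈ Set.Icc (0 : ℝ) (L / 2), 0 < Real.cos (a * s) := by
    intro s hs
    have h1 : 0 ≤ a * s := mul_nonneg hapos.le hs.1
    have h2 : a * s ≤ a * (L / 2) := mul_le_mul_of_nonneg_left hs.2 hapos.le
    apply Real.cos_pos_of_mem_Ioo
    constructor <;> linarith [Real.pi_pos]
  let u : ℝ → ℝ := fun s => Real.exp (-(f s) / m)
  let u1 : ℝ → ℝ := fun s => Real.exp (-(f s) / m) * (-(deriv f s) / m)
  let u2 : ℝ → ℝ := fun s => Real.exp (-(f s) / m) *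
    (-(deriv (deriv f) s - (1 / m) * (deriv f s) ^ 2) / m)
  have hu : ∀ s, HasDerivAt u (u1 s) s := fun s =>
    ((hf s).hasDerivAt.neg.div_const m).exp
  have hu1 : ∀ s, HasDerivAt u1 (u2 s) s := by
    intro s
    have := (hu s).mul ((hf' s).hasDerivAt.neg.div_const m)
    refine this.congr_deriv ?_
    simp only [u, u1, u2, Pi.neg_apply]
    field_simp
    ring
  have hupos : ∀ s, 0 < u s := fun s => Real.exp_pos _
  have hlin : ∀ k s : ℝ, HasDerivAt (fun s => k * s) k s := fun k s => by
    simpa using (hasDerivAt_id s).const_mul k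
  have hlow : ∀ s ∈ Set.Icc (0 : ℝ) L, -(a ^ 2) * u s ≤ u2 s := by
    intro s hs
    have h1 : -(a ^ 2) ≤ -(deriv (deriv f) s - (1 / m) * (deriv f s) ^ 2) / m := by
      rw [le_div_iff₀ hm]; linarith [(hineq s hs).2]
    have := mul_le_mul_of_nonneg_left h1 (hupos s).le
    simp only [u, u2] at this ⊢
    linarith
  have hup : ∀ s ∈ Set.Icc (0 : ℝ) L, u2 s ≤ b ^ 2 * u s := by
    intro s hs
    have h1 : -(deriv (deriv f) s - (1 / m) * (deriv f s) ^ 2) / m ≤ b ^ 2 := by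
      rw [div_le_iff₀ hm]; linarith [(hineq s hs).1]
    have := mul_le_mul_of_nonneg_left h1 (hupos s).le
    simp only [u, u2] at this ⊢
    linarith
  have A := cmp_aux u u1 u2 (fun s => Real.cos (a * s)) (fun s => -Real.sin (a * s) * a)
    (fun s => -(Real.cos (a * s) * a) * a) (L / 2) (by linarith) hu hu1
    (fun s => (hlin a s).cos) (fun s => ((hlin a s).sin.neg.mul_const a))
    (by simp [u1, hf0]) (by simp) hcos (by
      intro s hs
      have h1 := hlow s ⟨hs.1, by linarith [hs.2]⟩
      have := mul_le_mul_of_nonneg_right h1 (hcos s hs).le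
      linarith)
  have hr : ∀ s : ℝ, HasDerivAt (fun s => L - s) (-1) s := fun s => by
    simpa using (hasDerivAt_id s).const_sub L
  have B := cmp_aux (fun s => Real.cosh (b * s)) (fun s => Real.sinh (b * s) * b)
    (fun s => (Real.cosh (b * s) * b) * b)
    (fun s => u (L - s)) (fun s => u1 (L - s) * (-1)) (fun s => u2 (L - s) * (-1) * (-1))
    (L / 2) (by linarith)
    (fun s => (hlin b s).cosh) (fun s => ((hlin b s).sinh.mul_const b))
    (fun s => (hu (L - s)).comp s (hr s))
    (fun s => ((hu1 (L - s)).comp s (hr s)).mul_const (-1))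
    (by simp) (by simp [u1, hfL]) (fun s _ => hupos _) (by
      intro s hs
      have h1 := hup (L - s) ⟨by linarith [hs.2], by linarith [hs.1]⟩
      have := mul_le_mul_of_nonneg_left h1 (Real.cosh_pos (b * s)).le
      linarith)
  have e : L - L / 2 = L / 2 := by ring
  simp only [mul_zero, Real.cos_zero, Real.cosh_zero, sub_zero, mul_one, one_mul, e] at A B
  have hcL := hcos (L / 2) ⟨by linarith, le_refl _⟩
  have e2 : Real.exp ((f L - f 0) / m) = u 0 / u L := by
    simp only [u]
    rw [← Real.exp_sub]
    congr 1
    ring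
  rw [e2, div_le_div_iff₀ (hupos L) hcL]
  linarith
end
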